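/- Geometric convergence of Projected Push-Pull. Setup: X ⊆ ℝ^d nonempty closed convex with projection P_X; f_1, …, f_n : ℝ^d → ℝ differentiable, μ-strongly convex and L-smooth (0 < μ ≤ L); f = (1/n)Σ_i f_i with unique minimizer x* over X. Let {R_k} be row-stochastic and {C_k} be column-stochastic n×n matrices, and let {φ_k}, {π_k} be positive stochastic vectors with φ_{k+1}ᵀR_k = φ_kᵀ and π_{k+1} = C_k π_k, with uniform bounds [φ_k]_i ≥ φ_min > 0 and [π_k]_i ≥ ψ > 0 for all i, k. Assume uniform contraction constants σ, τ ∈ (0, 1): for every k and all u_1, …, u_n ∈ ℝ^d, √(Σ_i [φ_{k+1}]_i‖Σ_j [R_k]_{ij}u_j − û‖²) ≤ σ√(Σ_i [φ_k]_i‖u_i − û‖²) where û = Σ_j [φ_k]_j u_j; and for all y_1, …, y_n ∈ ℝ^d with v_i = Σ_j [C_k]_{ij}y_j, √(Σ_i [π_{k+1}]_i‖v_i/[π_{k+1}]_i − Σ_l y_l‖²) ≤ τ√(Σ_i [π_k]_i‖y_i/[π_k]_i − Σ_l y_l‖²). Set φ̄ = √(1/φ_min) and r = √(1/ψ) + √n.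 Run the iterates: x_i[0] = z_i[0] ∈ X, y_i[0] = ∇f_i(x_i[0]); x_i[k+1] = Σ_j [R_k]_{ij} z_j[k]; y_i[k+1] = Σ_j [C_k]_{ij} y_j[k] + ∇f_i(x_i[k+1]) − ∇f_i(x_i[k]); z_i[k+1] = (1 − λ)x_i[k+1] + λP_X(x_i[k+1] − η y_i[k+1]). If 0 < η < 1/(nL) and 0 < λ < min{(1 − σ)/(2φ̄√n), (1 − τ)/(rφ̄), ηnψμ(1 − σ)(1 − τ)/K} with K = (1 + ηnψμ)·φ̄·[2√n(1 − τ) + r(1 − σ) + 2r(1 + σ)], then there exist C ≥ 0 and ρ ∈ [0, 1) such that ‖x_i[k] − x*‖ ≤ C·ρᵏ for all agents i and all k ≥ 0; in particular lim_{k→∞} ‖x_i[k] − x*‖ = 0 for every i. -/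

import Mathlib

open Finset Filter RealInnerProductSpace

lemma le_of_sq_aux {a b : ℝ} (h : a ^ 2 ≤ b ^ 2) (hb : 0 ≤ b) : a ≤ b := by
  by_contra! hc
  nlinarith

/-- weighted norm -/
noncomputable def wn {ι E : Type*} [Fintype ι] [NormedAddCommGroup E] (w : ι → ℝ) (u : ι → E) : ℝ :=
  Real.sqrt (∑ i, w i * ‖u i‖ ^ 2)

section
variable {ι E : Type*} [Fintype ι] [NormedAddCommGroup E]

lemma wn_nonneg (w : ι → ℝ) (u : ι → E) : 0 ≤ wn w u := Real.sqrt_nonneg _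

lemma wn_sq {w : ι → ℝ} (hw : ∀ i, 0 ≤ w i) (u : ι → E) :
    wn w u ^ 2 = ∑ i, w i * ‖u i‖ ^ 2 :=
  Real.sq_sqrt (Finset.sum_nonneg fun i _ => mul_nonneg (hw i) (sq_nonneg _))

lemma wn_mono {E' : Type*} [NormedAddCommGroup E'] {w w' : ι → ℝ} (u : ι → E) (v : ι → E')
    (h : ∀ i, w i * ‖u i‖ ^ 2 ≤ w' i * ‖v i‖ ^ 2) : wn w u ≤ wn w' v :=
  Real.sqrt_le_sqrt (Finset.sum_le_sum fun i _ => h i)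

lemma wn_mono' {E' : Type*} [NormedAddCommGroup E'] {w : ι → ℝ} (hw : ∀ i, 0 ≤ w i)
    (u : ι → E) (v : ι → E')
    (h : ∀ i, ‖u i‖ ≤ ‖v i‖) : wn w u ≤ wn w v :=
  wn_mono u v fun i => mul_le_mul_of_nonneg_left (pow_le_pow_left₀ (norm_nonneg _) (h i) 2) (hw i)

lemma wn_smul [NormedSpace ℝ E] (w : ι → ℝ) {c : ℝ} (hc : 0 ≤ c) (u : ι → E) :
    wn w (fun i => c • u i) = c * wn w u := by
  unfold wn
  have : ∑ i, w i * ‖c • u i‖ ^ 2 = c ^ 2 * ∑ i, w i * ‖u i‖ ^ 2 := by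
    rw [Finset.mul_sum]
    refine Finset.sum_congr rfl fun i _ => ?_
    rw [norm_smul, Real.norm_of_nonneg hc]; ring
  rw [this, Real.sqrt_mul (sq_nonneg _), Real.sqrt_sq hc]

lemma wn_const {w : ι → ℝ} (hs : ∑ i, w i = 1) (c : E) : wn w (fun _ => c) = ‖c‖ := by
  unfold wn
  rw [← Finset.sum_mul, hs, one_mul, Real.sqrt_sq (norm_nonneg _)]

lemma wn_add {w : ι → ℝ} (hw : ∀ i, 0 ≤ w i) (u v : ι → E) :
    wn w (fun i => u i + v i) ≤ wn w u + wn w v := by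
  have key : ∀ u : ι → E, wn w u
      = ‖(WithLp.toLp 2 (fun i => Real.sqrt (w i) * ‖u i‖) : EuclideanSpace ℝ ι)‖ := by
    intro u
    rw [EuclideanSpace.norm_eq]
    unfold wn
    congr 1
    refine Finset.sum_congr rfl fun i _ => ?_
    simp [mul_pow, Real.sq_sqrt (hw i)]
  have h1 : wn w (fun i => u i + v i) ≤
      ‖(WithLp.toLp 2 (fun i => Real.sqrt (w i) * ‖u i‖) : EuclideanSpace ℝ ι)
        + WithLp.toLp 2 (fun i => Real.sqrt (w i) * ‖v i‖)‖ := by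
    rw [EuclideanSpace.norm_eq]
    unfold wn
    refine Real.sqrt_le_sqrt (Finset.sum_le_sum fun i _ => ?_)
    have : ‖u i + v i‖ ^ 2 ≤ (‖u i‖ + ‖v i‖) ^ 2 :=
      pow_le_pow_left₀ (norm_nonneg _) (norm_add_le _ _) 2
    simp only [PiLp.add_apply, Real.norm_eq_abs, sq_abs]
    rw [← mul_add, mul_pow, Real.sq_sqrt (hw i)]
    exact mul_le_mul_of_nonneg_left this (hw i)
  rw [key u, key v]
  exact h1.trans (norm_add_le _ _)

lemma norm_le_wn {w : ι → ℝ} (hw : ∀ i, 0 ≤ w i) {m : ℝ} (hm : 0 < m) (hmw : ∀ i, m ≤ w i)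
    (u : ι → E) (i : ι) : ‖u i‖ ≤ Real.sqrt (1 / m) * wn w u := by
  have h1 : m * ‖u i‖ ^ 2 ≤ wn w u ^ 2 := by
    rw [wn_sq hw]
    refine (mul_le_mul_of_nonneg_right (hmw i) (sq_nonneg _)).trans ?_
    exact Finset.single_le_sum (f := fun i => w i * ‖u i‖ ^ 2)
      (fun j _ => mul_nonneg (hw j) (sq_nonneg _)) (Finset.mem_univ i)
  refine le_of_sq_aux ?_ (mul_nonneg (Real.sqrt_nonneg _) (wn_nonneg _ _))
  rw [mul_pow, Real.sq_sqrt (by positivity), one_div_mul_eq_div, le_div_iff₀ hm]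
  linarith

lemma wn_one_le {w : ι → ℝ} {m : ℝ} (hm : 0 < m) (hmw : ∀ i, m ≤ w i)
    (u : ι → E) : wn (fun _ => 1) u ≤ Real.sqrt (1 / m) * wn w u := by
  unfold wn
  rw [← Real.sqrt_mul (by positivity), Finset.mul_sum]
  refine Real.sqrt_le_sqrt (Finset.sum_le_sum fun i _ => ?_)
  rw [← mul_assoc]
  refine mul_le_mul_of_nonneg_right ?_ (sq_nonneg _)
  rw [one_div_mul_eq_div, le_div_iff₀ hm]
  linarith [hmw i]

end

section
variable {ι E : Type*} [Fintype ι] [NormedAddCommGroup E] [InnerProductSpace ℝ E]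

lemma wn_var_sq {w : ι → ℝ} (hw : ∀ i, 0 ≤ w i) (hs : ∑ i, w i = 1) (u : ι → E) :
    wn w (fun i => u i - ∑ j, w j • u j) ^ 2 = wn w u ^ 2 - ‖∑ j, w j • u j‖ ^ 2 := by
  rw [wn_sq hw, wn_sq hw]
  set m := ∑ j, w j • u j with hm
  have : ∀ i, w i * ‖u i - m‖ ^ 2 = w i * ‖u i‖ ^ 2 - 2 * ⟪w i • u i, m⟫ + w i * ‖m‖ ^ 2 := by
    intro i
    rw [norm_sub_sq_real, inner_smul_left]
    simp; ring
  simp_rw [this]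
  rw [Finset.sum_add_distrib, Finset.sum_sub_distrib, ← Finset.mul_sum, ← sum_inner, ← hm,
    ← Finset.sum_mul, hs, real_inner_self_eq_norm_sq]
  ring

lemma wn_var_le {w : ι → ℝ} (hw : ∀ i, 0 ≤ w i) (hs : ∑ i, w i = 1) (u : ι → E) :
    wn w (fun i => u i - ∑ j, w j • u j) ≤ wn w u := by
  refine le_of_sq_aux ?_ (wn_nonneg _ _)
  rw [wn_var_sq hw hs]; nlinarith [sq_nonneg ‖∑ j, w j • u j‖]

lemma norm_mean_le {w : ι → ℝ} (hw : ∀ i, 0 ≤ w i) (hs : ∑ i, w i = 1) (u : ι → E) :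
    ‖∑ j, w j • u j‖ ≤ wn w u := by
  refine le_of_sq_aux ?_ (wn_nonneg _ _)
  have := wn_var_sq hw hs u
  nlinarith [sq_nonneg (wn w (fun i => u i - ∑ j, w j • u j))]

lemma wn_jensen {w w' : ι → ℝ} (hw' : ∀ i, 0 ≤ w' i)
    (R : ι → ι → ℝ) (hR : ∀ i j, 0 ≤ R i j) (hR1 : ∀ i, ∑ j, R i j = 1)
    (hwR : ∀ j, ∑ i, w' i * R i j = w j) (u : ι → E) :
    wn w' (fun i => ∑ j, R i j • u j) ≤ wn w u := by
  unfold wn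
  refine Real.sqrt_le_sqrt ?_
  calc ∑ i, w' i * ‖∑ j, R i j • u j‖ ^ 2 ≤ ∑ i, w' i * ∑ j, R i j * ‖u j‖ ^ 2 := by
        refine Finset.sum_le_sum fun i _ => mul_le_mul_of_nonneg_left ?_ (hw' i)
        rw [← wn_sq (hR i)]
        exact pow_le_pow_left₀ (norm_nonneg _) (norm_mean_le (hR i) (hR1 i) u) 2
    _ = ∑ j, w j * ‖u j‖ ^ 2 := by
        simp_rw [Finset.mul_sum]
        rw [Finset.sum_comm]
        refine Finset.sum_congr rfl fun j _ => ?_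
        rw [← hwR j, Finset.sum_mul]
        refine Finset.sum_congr rfl fun i _ => by ring
end

section
variable {E : Type*} [NormedAddCommGroup E] [InnerProductSpace ℝ E] [CompleteSpace E]

lemma grad_lower (f : E → ℝ) (g : E → E) (hg : ∀ x, HasGradientAt f (g x) x) (c : ℝ)
    (h : ∀ u v, c * ‖u - v‖ ^ 2 ≤ ⟪g u - g v, u - v⟫) (x y : E) :
    f x + ⟪g x, y - x⟫ + c / 2 * ‖y - x‖ ^ 2 ≤ f y := by
  set v := y - x with hv
  have hd : ∀ t : ℝ, HasDerivAt (fun t : ℝ => f (x + t • v) - t * ⟪g x, v⟫ - c / 2 * ‖v‖ ^ 2 * t ^ 2)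
      (⟪g (x + t • v), v⟫ - ⟪g x, v⟫ - c * ‖v‖ ^ 2 * t) t := by
    intro t
    have h1 : HasDerivAt (fun t : ℝ => x + t • v) v t := by
      simpa using ((hasDerivAt_id t).smul_const v).const_add x
    have h2 := (hg (x + t • v)).hasFDerivAt.comp_hasDerivAt t h1
    have h3 := (h2.sub ((hasDerivAt_id t).mul_const ⟪g x, v⟫)).sub
      ((hasDerivAt_pow 2 t).const_mul (c / 2 * ‖v‖ ^ 2))
    refine h3.congr_deriv ?_
    simp
    ring
  have hmono : MonotoneOn (fun t : ℝ => f (x + t • v) - t * ⟪g x, v⟫ - c / 2 * ‖v‖ ^ 2 * t ^ 2)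
      (Set.Icc 0 1) := by
    refine monotoneOn_of_deriv_nonneg (convex_Icc 0 1)
      (fun t _ => (hd t).continuousAt.continuousWithinAt)
      (fun t _ => (hd t).differentiableAt.differentiableWithinAt) ?_
    intro t ht
    rw [interior_Icc] at ht
    rw [(hd t).deriv]
    have := h (x + t • v) x
    rw [add_sub_cancel_left, norm_smul, Real.norm_of_nonneg ht.1.le, inner_smul_right,
      inner_sub_left] at this
    have h5 : t * (c * t * ‖v‖ ^ 2) ≤ t * (⟪g (x + t • v), v⟫ - ⟪g x, v⟫) := by
      nlinarith
    have := le_of_mul_le_mul_left h5 ht.1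
    linarith
  have := hmono (Set.left_mem_Icc.2 zero_le_one) (Set.right_mem_Icc.2 zero_le_one) zero_le_one
  simp [hv] at this
  simp [hv]
  linarith

lemma grad_upper (f : E → ℝ) (g : E → E) (hg : ∀ x, HasGradientAt f (g x) x) (c : ℝ)
    (h : ∀ u v, ‖g u - g v‖ ≤ c * ‖u - v‖) (x y : E) :
    f y ≤ f x + ⟪g x, y - x⟫ + c / 2 * ‖y - x‖ ^ 2 := by
  have := grad_lower (fun x => - f x) (fun x => - g x)
    (fun x => by
      have := (hg x).hasFDerivAt.neg
      rw [hasGradientAt_iff_hasFDerivAt]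
      rw [map_neg]
      exact this) (-c) (fun u v => by
      have h1 := real_inner_le_norm (g u - g v) (u - v)
      have h2 := mul_le_mul_of_nonneg_right (h u v) (norm_nonneg (u - v))
      have : ⟪-g u - -g v, u - v⟫ = - ⟪g u - g v, u - v⟫ := by
        rw [← inner_neg_left]; congr 1; abel
      rw [this]; nlinarith) x y
  simp only [inner_neg_left] at this
  linarith

lemma proj_vi {X : Set E} (hX : Convex ℝ X) {v p : E} (hp : p ∈ X)
    (h : ∀ u ∈ X, ‖v - p‖ ≤ ‖v - u‖) : ∀ u ∈ X, ⟪v - p, u - p⟫ ≤ 0 := by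
  refine (norm_eq_iInf_iff_real_inner_le_zero hX hp).1 ?_
  have : Nonempty X := ⟨⟨p, hp⟩⟩
  refine le_antisymm (le_ciInf fun u => h u u.2) ?_
  exact ciInf_le ⟨0, by rintro _ ⟨u, rfl⟩; exact norm_nonneg _⟩ (⟨p, hp⟩ : X)

lemma proj_nonexp {X : Set E} (hX : Convex ℝ X) {P : E → E} (hP : ∀ v, P v ∈ X)
    (h : ∀ v, ∀ u ∈ X, ‖v - P v‖ ≤ ‖v - u‖) (a b : E) : ‖P a - P b‖ ≤ ‖a - b‖ := by
  have h1 := proj_vi hX (hP a) (h a) _ (hP b)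
  have h2 := proj_vi hX (hP b) (h b) _ (hP a)
  have h3 : ‖P a - P b‖ ^ 2 ≤ ⟪a - b, P a - P b⟫ := by
    rw [← real_inner_self_eq_norm_sq]
    have e1 : ⟪a - P a, P b - P a⟫ = - ⟪a - P a, P a - P b⟫ := by
      rw [← inner_neg_right]; congr 1; abel
    have e2 : ⟪a - b, P a - P b⟫ = ⟪a - P a, P a - P b⟫ + ⟪P a - P b, P a - P b⟫
        - ⟪b - P b, P a - P b⟫ := by
      rw [← inner_add_left, ← inner_sub_left]; congr 1; abel
    linarith
  have h4 := real_inner_le_norm (a - b) (P a - P b)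
  by_contra! hc
  nlinarith [norm_nonneg (a - b)]

lemma min_vi {X : Set E} (hX : Convex ℝ X) (f : E → ℝ) (g xs : E) (hg : HasGradientAt f g xs)
    (hxs : xs ∈ X) (hmin : ∀ u ∈ X, f xs ≤ f u) (u : E) (hu : u ∈ X) : 0 ≤ ⟪g, u - xs⟫ := by
  have h1 : IsLocalMinOn f X xs := by
    filter_upwards [self_mem_nhdsWithin] with u hu using hmin u hu
  have := h1.hasFDerivWithinAt_nonneg hg.hasFDerivAt.hasFDerivWithinAt
    (sub_mem_posTangentConeAt_of_segment_subset (hX.segment_subset hxs hu))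
  simpa using this

/-- projected gradient contraction -/
lemma pg_contr {X : Set E} (hX : Convex ℝ X) {P : E → E} (hP : ∀ v, P v ∈ X)
    (hproj : ∀ v, ∀ u ∈ X, ‖v - P v‖ ≤ ‖v - u‖)
    (H : E → ℝ) (g : E → E) (hg : ∀ x, HasGradientAt H (g x) x)
    (m M β a : ℝ) (hβ : 0 < β) (hβM : β * M ≤ 1) (ha : 0 ≤ a) (ham : a ≤ β * m)
    (hlow : ∀ x y, H x + ⟪g x, y - x⟫ + m / 2 * ‖y - x‖ ^ 2 ≤ H y)
    (hup : ∀ x y, H y ≤ H x + ⟪g x, y - x⟫ + M / 2 * ‖y - x‖ ^ 2)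
    (xs : E) (hxs : xs ∈ X) (hmin : ∀ u ∈ X, H xs ≤ H u) (x : E) :
    ‖P (x - β • g x) - xs‖ ≤ (1 - a / (1 + a)) * ‖x - xs‖ := by
  set p := P (x - β • g x) with hp
  have h1 := hup x p
  have h2 := hlow x xs
  have h3 := hlow xs p
  have h4 := min_vi hX H (g xs) xs (hg xs) hxs hmin p (hP _)
  have h5 := proj_vi hX (hP _) (hproj (x - β • g x)) xs hxs
  rw [← hp] at h5
  have e1 : ⟪g x, p - x⟫ - ⟪g x, xs - x⟫ = - ⟪g x, xs - p⟫ := by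
    rw [← inner_sub_right, ← inner_neg_right]; congr 1; abel
  have e2 : ⟪x - β • g x - p, xs - p⟫ = ⟪x - p, xs - p⟫ - β * ⟪g x, xs - p⟫ := by
    rw [show x - β • g x - p = (x - p) - β • g x by abel, inner_sub_left, inner_smul_left]; simp
  have e3 : ‖x - xs‖ ^ 2 = ‖x - p‖ ^ 2 - 2 * ⟪x - p, xs - p⟫ + ‖xs - p‖ ^ 2 := by
    rw [← norm_sub_sq_real]; congr 2; abel
  have n1 : ‖xs - x‖ = ‖x - xs‖ := norm_sub_rev _ _
  have n2 : ‖p - x‖ = ‖x - p‖ := norm_sub_rev _ _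
  have n3 : ‖xs - p‖ = ‖p - xs‖ := norm_sub_rev _ _
  rw [n1] at h2; rw [n2] at h1; rw [n3] at e3
  set A := ‖x - xs‖
  set B := ‖p - xs‖
  set D := ‖x - p‖
  have hA : 0 ≤ A := norm_nonneg _
  have hB : 0 ≤ B := norm_nonneg _
  -- combine
  have k1 : m / 2 * B ^ 2 + m / 2 * A ^ 2 ≤ -⟪g x, xs - p⟫ + M / 2 * D ^ 2 := by linarith
  have k2 : β * (m / 2 * B ^ 2 + m / 2 * A ^ 2) ≤ β * (-⟪g x, xs - p⟫ + M / 2 * D ^ 2) :=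
    mul_le_mul_of_nonneg_left k1 hβ.le
  have k3 : β * M * D ^ 2 ≤ 1 * D ^ 2 := mul_le_mul_of_nonneg_right hβM (sq_nonneg _)
  have k4 : (1 + β * m) * B ^ 2 ≤ (1 - β * m) * A ^ 2 := by nlinarith
  have k5 : (1 + a) * B ^ 2 ≤ (1 - a) * A ^ 2 := by nlinarith [sq_nonneg A, sq_nonneg B]
  have k6 : ((1 + a) * B) ^ 2 ≤ A ^ 2 := by nlinarith [sq_nonneg (a * A)]
  have k7 : (1 + a) * B ≤ A := le_of_sq_aux k6 hA
  have : 1 - a / (1 + a) = 1 / (1 + a) := by field_simp; ring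
  rw [this, one_div_mul_eq_div, le_div_iff₀ (by linarith)]
  linarith
end

lemma rec_bound (e D s G : ℕ → ℝ) (lam c α σ τ Q δ ς : ℝ) (hδ : 0 < δ) (hς : 0 < ς)
    (hl0 : 0 < lam) (hl1 : lam ≤ 1) (hc1 : c ≤ 1) (hα : 0 ≤ α) (hσ : 0 ≤ σ) (hτ : 0 ≤ τ)
    (hQ : 0 ≤ Q) (he0 : 0 ≤ e 0)
    (he : ∀ k, e (k + 1) ≤ (1 - lam * c) * e k + lam * (α * D k) + lam * s k)
    (hD : ∀ k, D (k + 1) ≤ σ * (D k + lam * G k))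
    (hs : ∀ k, s (k + 1) ≤ τ * s k + Q * (D k + lam * G k))
    (hG : ∀ k, G k ≤ (2 - c) * e k + α * D k + s k)
    (h1 : α * δ + ς < c) (h2 : σ * (δ + 2 * lam) < δ) (h3 : τ * ς + Q * (δ + 2 * lam) < ς) :
    ∃ V ρ : ℝ, 0 ≤ V ∧ 0 < ρ ∧ ρ < 1 ∧ ∀ k, e k ≤ V * ρ ^ k := by
  have hc0 : 0 < c := lt_of_le_of_lt (by positivity) h1
  set ρ := max (1 / 2) (max (1 - lam * (c - α * δ - ς)) (max (σ * (δ + 2 * lam) / δ)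
    ((τ * ς + Q * (δ + 2 * lam)) / ς))) with hρ
  have r0 : 1 / 2 ≤ ρ := le_max_left _ _
  have r1 : 1 - lam * (c - α * δ - ς) ≤ ρ := (le_max_left _ _).trans (le_max_right _ _)
  have r2 : σ * (δ + 2 * lam) / δ ≤ ρ :=
    ((le_max_left _ _).trans (le_max_right _ _)).trans (le_max_right _ _)
  have r3 : (τ * ς + Q * (δ + 2 * lam)) / ς ≤ ρ :=
    ((le_max_right _ _).trans (le_max_right _ _)).trans (le_max_right _ _)
  have hρ1 : ρ < 1 := by
    refine max_lt (by norm_num) (max_lt ?_ (max_lt ?_ ?_))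
    · have : 0 < lam * (c - α * δ - ς) := mul_pos hl0 (by linarith)
      linarith
    · rwa [div_lt_one hδ]
    · rwa [div_lt_one hς]
  rw [div_le_iff₀ hδ] at r2
  rw [div_le_iff₀ hς] at r3
  set V := max (e 0) (max (D 0 / δ) (s 0 / ς)) with hV
  have v1 : e 0 ≤ V := le_max_left _ _
  have v2 : D 0 / δ ≤ V := (le_max_left _ _).trans (le_max_right _ _)
  have v3 : s 0 / ς ≤ V := (le_max_right _ _).trans (le_max_right _ _)
  rw [div_le_iff₀ hδ] at v2
  rw [div_le_iff₀ hς] at v3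
  have hV0 : 0 ≤ V := he0.trans v1
  have key : ∀ k, e k ≤ V * ρ ^ k ∧ D k ≤ δ * (V * ρ ^ k) ∧ s k ≤ ς * (V * ρ ^ k) := by
    intro k
    induction k with
    | zero => simp only [pow_zero, mul_one]; exact ⟨v1, by linarith, by linarith⟩
    | succ k ih =>
      obtain ⟨i1, i2, i3⟩ := ih
      have hW : 0 ≤ V * ρ ^ k := by positivity
      rw [pow_succ, ← mul_assoc]
      set W := V * ρ ^ k
      have a1 : α * D k ≤ α * (δ * W) := mul_le_mul_of_nonneg_left i2 hα
      have g1 : G k ≤ 2 * W := by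
        have b1 : (2 - c) * e k ≤ (2 - c) * W := mul_le_mul_of_nonneg_left i1 (by linarith)
        have b2 : (α * δ + ς) * W ≤ c * W := mul_le_mul_of_nonneg_right h1.le hW
        linarith [hG k]
      have g2 : D k + lam * G k ≤ (δ + 2 * lam) * W := by
        have := mul_le_mul_of_nonneg_left g1 hl0.le
        linarith
      refine ⟨?_, ?_, ?_⟩
      · have b1 : (1 - lam * c) * e k ≤ (1 - lam * c) * W :=
          mul_le_mul_of_nonneg_left i1 (by linarith [mul_le_one₀ hl1 hc0.le hc1])
        have b2 := mul_le_mul_of_nonneg_left (add_le_add a1 i3) hl0.le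
        have b3 := mul_le_mul_of_nonneg_right r1 hW
        linarith [he k]
      · have b1 := mul_le_mul_of_nonneg_left g2 hσ
        have b3 := mul_le_mul_of_nonneg_right r2 hW
        linarith [hD k]
      · have b1 := mul_le_mul_of_nonneg_left g2 hQ
        have b2 := mul_le_mul_of_nonneg_left i3 hτ
        have b3 := mul_le_mul_of_nonneg_right r3 hW
        linarith [hs k]
  exact ⟨V, ρ, hV0, by linarith, hρ1, fun k => (key k).1⟩

/-- choice of the test vector -/
lemma param_choice (lam c σ τ φbar sψ sn r Q : ℝ) (hl0 : 0 < lam) (hσ0 : 0 < σ) (hσ1 : σ < 1)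
    (hτ0 : 0 < τ) (hτ1 : τ < 1) (hφ : 1 ≤ φbar) (hsψ : 1 ≤ sψ) (hsn : 1 ≤ sn) (hr : r = sψ + sn)
    (hQ : Q ≤ φbar * sψ * (1 + σ))
    (h : lam * (φbar * (2 * sn * (1 - τ) + r * (1 - σ) + 2 * r * (1 + σ)))
      < c * ((1 - σ) * (1 - τ))) :
    ∃ δ ς : ℝ, 0 < δ ∧ 0 < ς ∧ (1 + φbar) * δ + ς < c ∧ σ * (δ + 2 * lam) < δ ∧
      τ * ς + Q * (δ + 2 * lam) < ς := by
  have s1 : 0 < 1 - σ := by linarith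
  have t1 : 0 < 1 - τ := by linarith
  refine ⟨lam * (1 + 3 * σ) / (2 * (1 - σ)), lam * φbar * sψ * (3 + σ) / ((1 - σ) * (1 - τ)),
    by positivity, by positivity, ?_, ?_, ?_⟩
  · have e1 : (1 + φbar) * (lam * (1 + 3 * σ) / (2 * (1 - σ)))
      + lam * φbar * sψ * (3 + σ) / ((1 - σ) * (1 - τ))
      = ((1 + φbar) * lam * (1 + 3 * σ) / 2 * (1 - τ) + lam * φbar * sψ * (3 + σ))
        / ((1 - σ) * (1 - τ)) := by
      field_simp
    rw [e1, div_lt_iff₀ (by positivity)]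
    refine lt_of_le_of_lt ?_ h
    subst hr
    have q1 : (1 + φbar) * lam * (1 + 3 * σ) / 2 * (1 - τ) ≤ (4 * φbar * lam) * (1 - τ) := by
      refine mul_le_mul_of_nonneg_right ?_ t1.le
      have : (1 + φbar) * (1 + 3 * σ) ≤ (2 * φbar) * 4 := by
        apply mul_le_mul <;> linarith
      nlinarith
    have q2 : φbar * lam * (4 * (1 - τ)) ≤ φbar * lam * (2 * sn * (1 - τ) + sn * (3 + σ)) := by
      refine mul_le_mul_of_nonneg_left ?_ (by positivity)
      have w1 : 1 * (2 * (1 - τ) + (3 + σ)) ≤ sn * (2 * (1 - τ) + (3 + σ)) :=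
        mul_le_mul_of_nonneg_right hsn (by linarith)
      linarith
    linarith
  · have e1 : lam * (1 + 3 * σ) / (2 * (1 - σ)) + 2 * lam
      = lam * (5 - σ) / (2 * (1 - σ)) := by field_simp; ring
    rw [e1, ← mul_div_assoc]
    apply div_lt_div_of_pos_right _ (by positivity)
    nlinarith [mul_pos hl0 (mul_pos s1 s1)]
  · have e1 : lam * (1 + 3 * σ) / (2 * (1 - σ)) + 2 * lam
      = lam * (5 - σ) / (2 * (1 - σ)) := by field_simp; ring
    rw [e1]
    have e2 : lam * φbar * sψ * (3 + σ) / ((1 - σ) * (1 - τ)) =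
      τ * (lam * φbar * sψ * (3 + σ) / ((1 - σ) * (1 - τ))) + lam * φbar * sψ * (3 + σ) / (1 - σ) := by
      field_simp; ring
    have p1 : 0 < lam * (5 - σ) / (2 * (1 - σ)) := by
      have : 0 < 5 - σ := by linarith
      positivity
    have e3 := mul_le_mul_of_nonneg_right hQ p1.le
    have e4 : φbar * sψ * (1 + σ) * (lam * (5 - σ) / (2 * (1 - σ)))
       < lam * φbar * sψ * (3 + σ) / (1 - σ) := by
      rw [show φbar * sψ * (1 + σ) * (lam * (5 - σ) / (2 * (1 - σ)))
        = lam * φbar * sψ * ((1 + σ) * (5 - σ) / 2) / (1 - σ) by field_simp]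
      apply div_lt_div_of_pos_right _ s1
      apply mul_lt_mul_of_pos_left _ (by positivity)
      nlinarith [mul_pos s1 s1]
    linarith

set_option maxHeartbeats 4000000 in
/-- Geometric convergence of Projected Push-Pull,
Theorem `convergence-of-protocol`. Under strong convexity, smoothness, projection,
stochastic-weight and uniform-contraction hypotheses, for `0 < η < 1/(nL)` and `λ` small
enough the iterates of Projected Push-Pull converge geometrically to the constrained
optimum: `‖x_i[k] − x*‖ ≤ C ρ^k` for some `C ≥ 0`, `ρ ∈ [0, 1)`, and in particular
`‖x_i[k] − x*‖ → 0`. -/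
theorem projected_push_pull_convergence {n d : ℕ} [NeZero n]
    (X : Set (EuclideanSpace ℝ (Fin d))) (hXne : X.Nonempty)
    (hXclosed : IsClosed X) (hXconvex : Convex ℝ X)
    (P : EuclideanSpace ℝ (Fin d) → EuclideanSpace ℝ (Fin d))
    (hPmem : ∀ v, P v ∈ X)
    (hPproj : ∀ v, ∀ u ∈ X, ‖v - P v‖ ≤ ‖v - u‖)
    (f : Fin n → EuclideanSpace ℝ (Fin d) → ℝ)
    (hfdiff : ∀ i, Differentiable ℝ (f i))
    (μ L : ℝ) (hμ : 0 < μ) (hμL : μ ≤ L)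
    (hstrong : ∀ i u v, μ * ‖u - v‖ ^ 2 ≤ ⟪gradient (f i) u - gradient (f i) v, u - v⟫)
    (hsmooth : ∀ i u v, ‖gradient (f i) u - gradient (f i) v‖ ≤ L * ‖u - v‖)
    (F : EuclideanSpace ℝ (Fin d) → ℝ)
    (hF : F = fun v => (1 / (n : ℝ)) * ∑ l, f l v)
    (xs : EuclideanSpace ℝ (Fin d)) (hxsmem : xs ∈ X)
    (hxsmin : ∀ u ∈ X, F xs ≤ F u)
    (hxsuniq : ∀ u ∈ X, (∀ v ∈ X, F u ≤ F v) → u = xs)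
    (R C : ℕ → Fin n → Fin n → ℝ)
    (hRnonneg : ∀ k i j, 0 ≤ R k i j) (hRrow : ∀ k i, ∑ j, R k i j = 1)
    (hCnonneg : ∀ k i j, 0 ≤ C k i j) (hCcol : ∀ k j, ∑ i, C k i j = 1)
    (φ π : ℕ → Fin n → ℝ)
    (hφpos : ∀ k i, 0 < φ k i) (hφsum : ∀ k, ∑ i, φ k i = 1)
    (hπpos : ∀ k i, 0 < π k i) (hπsum : ∀ k, ∑ i, π k i = 1)
    (hφR : ∀ k j, ∑ i, φ (k + 1) i * R k i j = φ k j)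
    (hπC : ∀ k i, π (k + 1) i = ∑ j, C k i j * π k j)
    (φmin ψ : ℝ) (hφmin0 : 0 < φmin) (hψ0 : 0 < ψ)
    (hφmin : ∀ k i, φmin ≤ φ k i) (hψ : ∀ k i, ψ ≤ π k i)
    (σ τ : ℝ) (hσ0 : 0 < σ) (hσ1 : σ < 1) (hτ0 : 0 < τ) (hτ1 : τ < 1)
    (hRcontr : ∀ (k : ℕ) (u : Fin n → EuclideanSpace ℝ (Fin d)),
      Real.sqrt (∑ i, φ (k + 1) i * ‖(∑ j, R k i j • u j) - (∑ j, φ k j • u j)‖ ^ 2)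
        ≤ σ * Real.sqrt (∑ i, φ k i * ‖u i - (∑ j, φ k j • u j)‖ ^ 2))
    (hCcontr : ∀ (k : ℕ) (y : Fin n → EuclideanSpace ℝ (Fin d)),
      Real.sqrt (∑ i, π (k + 1) i * ‖(π (k + 1) i)⁻¹ • (∑ j, C k i j • y j) - (∑ l, y l)‖ ^ 2)
        ≤ τ * Real.sqrt (∑ i, π k i * ‖(π k i)⁻¹ • y i - (∑ l, y l)‖ ^ 2))
    (φbar r : ℝ)
    (hφbar : φbar = Real.sqrt (1 / φmin))
    (hr : r = Real.sqrt (1 / ψ) + Real.sqrt (n : ℝ))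
    (x y z : ℕ → Fin n → EuclideanSpace ℝ (Fin d))
    (hxinitmem : ∀ i, x 0 i ∈ X) (hzinit : ∀ i, z 0 i = x 0 i)
    (hyinit : ∀ i, y 0 i = gradient (f i) (x 0 i))
    (hxiter : ∀ k i, x (k + 1) i = ∑ j, R k i j • z k j)
    (hyiter : ∀ k i, y (k + 1) i =
      (∑ j, C k i j • y k j) + gradient (f i) (x (k + 1) i) - gradient (f i) (x k i))
    (η lam K : ℝ) (hη0 : 0 < η) (hη : η < 1 / (n * L))
    (hziter : ∀ k i, z (k + 1) i =
      (1 - lam) • x (k + 1) i + lam • P (x (k + 1) i - η • y (k + 1) i))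
    (hK : K = (1 + η * n * ψ * μ) * φbar
      * (2 * Real.sqrt (n : ℝ) * (1 - τ) + r * (1 - σ) + 2 * r * (1 + σ)))
    (hlam0 : 0 < lam)
    (hlam : lam < min ((1 - σ) / (2 * φbar * Real.sqrt (n : ℝ)))
      (min ((1 - τ) / (r * φbar)) (η * n * ψ * μ * (1 - σ) * (1 - τ) / K))) :
    ∃ Cconst ρ : ℝ, 0 ≤ Cconst ∧ 0 ≤ ρ ∧ ρ < 1 ∧
      (∀ (i : Fin n) (k : ℕ), ‖x k i - xs‖ ≤ Cconst * ρ ^ k) ∧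
      (∀ i : Fin n, Tendsto (fun k => ‖x k i - xs‖) atTop (nhds 0)) := by
  classical
  have hn1 : (1 : ℝ) ≤ n := by exact_mod_cast NeZero.one_le
  have hn0 : (0 : ℝ) < n := by linarith
  have i0 : Fin n := ⟨0, NeZero.pos n⟩
  have hL : 0 < L := by linarith
  have hφ0 : ∀ k i, 0 ≤ φ k i := fun k i => (hφpos k i).le
  have hπ0 : ∀ k i, 0 ≤ π k i := fun k i => (hπpos k i).le
  have hφle : ∀ k i, φ k i ≤ 1 := fun k i => by
    rw [← hφsum k]; exact Finset.single_le_sum (fun j _ => hφ0 k j) (Finset.mem_univ i)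
  have hπle : ∀ k i, π k i ≤ 1 := fun k i => by
    rw [← hπsum k]; exact Finset.single_le_sum (fun j _ => hπ0 k j) (Finset.mem_univ i)
  have hψ1 : ψ ≤ 1 := (hψ 0 i0).trans (hπle 0 i0)
  have hnφ : n * φmin ≤ 1 := by
    rw [← hφsum 0]
    have := Finset.sum_le_sum (fun i (_ : i ∈ (Finset.univ : Finset (Fin n))) => hφmin 0 i)
    simpa using this
  have hφb0 : 0 ≤ φbar := hφbar ▸ Real.sqrt_nonneg _
  have hsnφ : Real.sqrt n ≤ φbar := by
    rw [hφbar]; apply Real.sqrt_le_sqrt; rw [le_div_iff₀ hφmin0]; exact hnφ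
  have hsn : 1 ≤ Real.sqrt n := Real.one_le_sqrt.2 hn1
  have hφb1 : 1 ≤ φbar := hsn.trans hsnφ
  set sψ := Real.sqrt (1 / ψ) with hsψd
  have hsψ : 1 ≤ sψ := Real.one_le_sqrt.2 (by rw [le_div_iff₀ hψ0]; linarith)
  have hηL : η * n * L ≤ 1 := by
    rw [lt_div_iff₀ (by positivity)] at hη; linarith
  set a := η * n * ψ * μ with ha_def
  have ha0 : 0 < a := by positivity
  set c := a / (1 + a) with hc_def
  have hc1 : c ≤ 1 := by rw [hc_def, div_le_one (by linarith)]; linarith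
  have s1 : 0 < 1 - σ := by linarith
  have t1 : 0 < 1 - τ := by linarith
  obtain ⟨hlamA, hlamBC⟩ := lt_min_iff.1 hlam
  obtain ⟨hlamB, hlamC⟩ := lt_min_iff.1 hlamBC
  have hl1 : lam ≤ 1 := by
    rw [lt_div_iff₀ (by positivity)] at hlamA
    have : 1 ≤ 2 * φbar * Real.sqrt n := by nlinarith
    nlinarith
  have hr0 : 0 < r := by rw [hr]; linarith
  have hpar : lam * (φbar * (2 * Real.sqrt n * (1 - τ) + r * (1 - σ) + 2 * r * (1 + σ)))
      < c * ((1 - σ) * (1 - τ)) := by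
    have hK0 : 0 < K := by rw [hK]; positivity
    rw [lt_div_iff₀ hK0, hK] at hlamC
    rw [hc_def, div_mul_eq_mul_div, lt_div_iff₀ (by linarith)]
    linarith
  -- gradients
  have hgrad : ∀ i u, HasGradientAt (f i) (gradient (f i) u) u := fun i u =>
    (hfdiff i u).hasGradientAt
  set H : EuclideanSpace ℝ (Fin d) → ℝ := fun v => ∑ l, f l v with hH
  set g : EuclideanSpace ℝ (Fin d) → EuclideanSpace ℝ (Fin d) :=
    fun v => ∑ l, gradient (f l) v with hg
  have hHg : ∀ u, HasGradientAt H (g u) u := by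
    intro u
    rw [hasGradientAt_iff_hasFDerivAt]
    have := HasFDerivAt.fun_sum (u := Finset.univ) (fun i _ => (hgrad i u).hasFDerivAt)
    rw [hg]
    simp only [map_sum]
    exact this
  have hHlow : ∀ u v, H u + ⟪g u, v - u⟫ + (n * μ) / 2 * ‖v - u‖ ^ 2 ≤ H v := by
    intro u v
    have := Finset.sum_le_sum (fun i (_ : i ∈ (Finset.univ : Finset (Fin n))) =>
      grad_lower (f i) (gradient (f i)) (hgrad i) μ (hstrong i) u v)
    simp only [Finset.sum_add_distrib, ← sum_inner, Finset.sum_const, Finset.card_univ,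
      Fintype.card_fin, nsmul_eq_mul] at this
    simp only [hH, hg]
    linarith
  have hHup : ∀ u v, H v ≤ H u + ⟪g u, v - u⟫ + (n * L) / 2 * ‖v - u‖ ^ 2 := by
    intro u v
    have := Finset.sum_le_sum (fun i (_ : i ∈ (Finset.univ : Finset (Fin n))) =>
      grad_upper (f i) (gradient (f i)) (hgrad i) L (hsmooth i) u v)
    simp only [Finset.sum_add_distrib, ← sum_inner, Finset.sum_const, Finset.card_univ,
      Fintype.card_fin, nsmul_eq_mul] at this
    simp only [hH, hg]
    linarith
  have hHmin : ∀ u ∈ X, H xs ≤ H u := by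
    intro u hu
    have := hxsmin u hu
    rw [hF] at this
    exact le_of_mul_le_mul_left this (by positivity)
  have hsumy : ∀ k, ∑ i, y k i = ∑ i, gradient (f i) (x k i) := by
    intro k
    induction k with
    | zero => exact Finset.sum_congr rfl fun i _ => hyinit i
    | succ k ih =>
      simp only [hyiter, Finset.sum_sub_distrib, Finset.sum_add_distrib]
      rw [Finset.sum_comm]
      simp only [← Finset.sum_smul, hCcol, one_smul]
      rw [ih]; abel
  -- the error quantities
  set xh : ℕ → EuclideanSpace ℝ (Fin d) := fun k => ∑ j, φ k j • x k j with hxh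
  set e : ℕ → ℝ := fun k => wn (φ k) (fun i => x k i - xs) with he_def
  set D : ℕ → ℝ := fun k => wn (φ k) (fun i => x k i - xh k) with hD_def
  set S : ℕ → ℝ := fun k => wn (π k) (fun i => (π k i)⁻¹ • y k i - ∑ l, y k l) with hS_def
  set p : ℕ → Fin n → EuclideanSpace ℝ (Fin d) := fun k i => P (x k i - η • y k i) with hp_def
  set G : ℕ → ℝ := fun k => wn (φ k) (fun i => p k i - x k i) with hG_def
  have he0 : ∀ k, 0 ≤ e k := fun k => wn_nonneg _ _
  have hD0 : ∀ k, 0 ≤ D k := fun k => wn_nonneg _ _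
  have hS0 : ∀ k, 0 ≤ S k := fun k => wn_nonneg _ _
  have hG0 : ∀ k, 0 ≤ G k := fun k => wn_nonneg _ _
  have hDi : ∀ k i, ‖x k i - xh k‖ ≤ φbar * D k := by
    intro k i
    rw [hφbar]
    exact norm_le_wn (hφ0 k) hφmin0 (hφmin k) (fun i => x k i - xh k) i
  have hpi : ∀ k i, ‖p k i - xs‖ ≤ (1 - c) * ‖x k i - xs‖ + ‖x k i - xh k‖ + φbar * D k
      + η * (π k i * ‖(π k i)⁻¹ • y k i - ∑ l, y k l‖) := by
    intro k i
    have hβM : η * π k i * (n * L) ≤ 1 := by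
      have : π k i * (η * n * L) ≤ 1 := mul_le_one₀ (hπle k i) (by positivity) hηL
      linarith
    have ham : a ≤ η * π k i * (n * μ) := by
      have := mul_le_mul_of_nonneg_left (hψ k i) (show 0 ≤ η * n * μ by positivity)
      rw [ha_def]; linarith
    have b1 := pg_contr hXconvex hPmem hPproj H g hHg (n * μ) (n * L) (η * π k i) a
      (mul_pos hη0 (hπpos k i)) hβM ha0.le ham hHlow hHup xs hxsmem hHmin (x k i)
    have b2 := proj_nonexp hXconvex hPmem hPproj (x k i - η • y k i)
      (x k i - (η * π k i) • g (x k i))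
    have b3 : ‖(x k i - η • y k i) - (x k i - (η * π k i) • g (x k i))‖
        ≤ η * (π k i * ‖(π k i)⁻¹ • y k i - ∑ l, y k l‖)
          + η * (π k i * ‖(∑ l, y k l) - g (x k i)‖) := by
      have : (x k i - η • y k i) - (x k i - (η * π k i) • g (x k i))
          = -(η • π k i • ((π k i)⁻¹ • y k i - ∑ l, y k l)) -
            η • π k i • ((∑ l, y k l) - g (x k i)) := by
        rw [smul_sub (π k i) ((π k i)⁻¹ • y k i), smul_inv_smul₀ (hπpos k i).ne']
        module
      rw [this]
      refine (norm_sub_le _ _).trans (le_of_eq ?_)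
      rw [norm_neg]
      simp only [norm_smul, Real.norm_of_nonneg hη0.le, Real.norm_of_nonneg (hπ0 k i)]
    have b4 : ‖(∑ l, y k l) - g (x k i)‖ ≤ n * L * (‖x k i - xh k‖ + φbar * D k) := by
      rw [hsumy, hg, ← Finset.sum_sub_distrib]
      refine (norm_sum_le _ _).trans ?_
      have : ∀ l ∈ (Finset.univ : Finset (Fin n)),
          ‖gradient (f l) (x k l) - gradient (f l) (x k i)‖
            ≤ L * (‖x k i - xh k‖ + φbar * D k) := by
        intro l _
        refine (hsmooth l _ _).trans (mul_le_mul_of_nonneg_left ?_ hL.le)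
        have q1 : ‖x k l - x k i‖ ≤ ‖x k l - xh k‖ + ‖x k i - xh k‖ := by
          rw [show x k l - x k i = (x k l - xh k) - (x k i - xh k) by abel]
          exact norm_sub_le _ _
        linarith [hDi k l]
      refine (Finset.sum_le_sum this).trans (le_of_eq ?_)
      simp; ring
    have b5 : η * (π k i * ‖(∑ l, y k l) - g (x k i)‖) ≤ ‖x k i - xh k‖ + φbar * D k := by
      have hT : 0 ≤ ‖x k i - xh k‖ + φbar * D k :=
        add_nonneg (norm_nonneg _) (mul_nonneg hφb0 (hD0 k))
      have q1 := mul_le_mul_of_nonneg_left b4 (mul_pos hη0 (hπpos k i)).le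
      have q2 := mul_le_mul_of_nonneg_right hβM hT
      linarith
    have b6 : ‖p k i - xs‖ ≤ ‖p k i - P (x k i - (η * π k i) • g (x k i))‖
        + ‖P (x k i - (η * π k i) • g (x k i)) - xs‖ := norm_sub_le_norm_sub_add_norm_sub _ _ _
    have b2' : ‖p k i - P (x k i - (η * π k i) • g (x k i))‖ ≤ _ := b2
    linarith
  have hpw : ∀ k, wn (φ k) (fun i => p k i - xs) ≤ (1 - c) * e k + (1 + φbar) * D k + η * S k := by
    intro k
    have q1 : wn (φ k) (fun i => p k i - xs) ≤ wn (φ k) (fun i =>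
      ((1 - c) • ‖x k i - xs‖ + ‖x k i - xh k‖ + φbar * D k)
      + η • (π k i * ‖(π k i)⁻¹ • y k i - ∑ l, y k l‖)) := by
      refine wn_mono' (hφ0 k) _ _ fun i => ?_
      exact (hpi k i).trans (le_abs_self _)
    have q2 := wn_add (hφ0 k) (fun i => (1 - c) • ‖x k i - xs‖ + ‖x k i - xh k‖ + φbar * D k)
      (fun i => η • (π k i * ‖(π k i)⁻¹ • y k i - ∑ l, y k l‖))
    have q3 := wn_add (hφ0 k) (fun i => (1 - c) • ‖x k i - xs‖ + ‖x k i - xh k‖)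
      (fun i => φbar * D k)
    have q4 := wn_add (hφ0 k) (fun i => (1 - c) • ‖x k i - xs‖) (fun i => ‖x k i - xh k‖)
    rw [wn_smul _ (by linarith)] at q4
    rw [wn_const (hφsum k), Real.norm_of_nonneg (mul_nonneg hφb0 (hD0 k))] at q3
    rw [wn_smul _ hη0.le] at q2
    have q5 : wn (φ k) (fun i => ‖x k i - xs‖) ≤ e k :=
      wn_mono' (hφ0 k) _ _ fun i => by rw [norm_norm]
    have q6 : wn (φ k) (fun i => ‖x k i - xh k‖) ≤ D k :=
      wn_mono' (hφ0 k) _ _ fun i => by rw [norm_norm]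
    have q7 : wn (φ k) (fun i => π k i * ‖(π k i)⁻¹ • y k i - ∑ l, y k l‖) ≤ S k := by
      refine wn_mono _ _ fun i => ?_
      rw [norm_mul, norm_norm, mul_pow, Real.norm_of_nonneg (hπ0 k i), ← mul_assoc]
      refine mul_le_mul_of_nonneg_right ?_ (sq_nonneg _)
      have w1 : φ k i * π k i ≤ 1 := mul_le_one₀ (hφle k i) (hπ0 k i) (hπle k i)
      have := mul_le_mul_of_nonneg_right w1 (hπ0 k i)
      linarith
    have q5' := mul_le_mul_of_nonneg_left q5 (show 0 ≤ 1 - c by linarith)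
    have q7' := mul_le_mul_of_nonneg_left q7 hη0.le
    linarith
  have hGk : ∀ k, G k ≤ (2 - c) * e k + (1 + φbar) * D k + η * S k := by
    intro k
    have q1 := wn_add (hφ0 k) (fun i => p k i - xs) (fun i => xs - x k i)
    have q2 : wn (φ k) (fun i => xs - x k i) ≤ e k :=
      wn_mono' (hφ0 k) _ _ fun i => by rw [norm_sub_rev]
    simp only [sub_add_sub_cancel] at q1
    have q1' : G k ≤ _ := q1
    linarith [hpw k]
  have hz : ∀ k i, z (k + 1) i = (1 - lam) • x (k + 1) i + lam • p (k + 1) i := hziter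
  have hz2 : ∀ k i, z (k + 1) i = x (k + 1) i + lam • (p (k + 1) i - x (k + 1) i) := by
    intro k i; rw [hz]; module
  have hxhz : ∀ k, xh (k + 1) = ∑ j, φ k j • z k j := by
    intro k
    simp only [hxh, hxiter, Finset.smul_sum, smul_smul]
    rw [Finset.sum_comm]
    refine Finset.sum_congr rfl fun j _ => ?_
    rw [← Finset.sum_smul, hφR]
  have hxhd : ∀ k, xh (k + 2) = xh (k + 1) + lam • ∑ j, φ (k + 1) j • (p (k + 1) j - x (k + 1) j) := by
    intro k
    rw [hxhz (k + 1)]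
    simp only [hz2, hxh, smul_add, Finset.sum_add_distrib, Finset.smul_sum]
    congr 1
    refine Finset.sum_congr rfl fun j _ => ?_
    rw [smul_comm]
  have hE : ∀ k, e (k + 2) ≤ (1 - lam * c) * e (k + 1) + lam * ((1 + φbar) * D (k + 1))
      + lam * (η * S (k + 1)) := by
    intro k
    have q1 : e (k + 2) ≤ wn (φ (k + 1)) (fun i => z (k + 1) i - xs) := by
      have := wn_jensen (hφ0 (k + 2)) (R (k + 1)) (hRnonneg _) (hRrow _) (hφR (k + 1))
        (fun i => z (k + 1) i - xs)
      refine le_trans (le_of_eq ?_) this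
      simp only [he_def]
      congr 1
      funext i
      rw [hxiter]
      simp only [smul_sub, Finset.sum_sub_distrib, ← Finset.sum_smul, hRrow, one_smul]
    have q2 := wn_add (hφ0 (k + 1)) (fun i => (1 - lam) • (x (k + 1) i - xs))
      (fun i => lam • (p (k + 1) i - xs))
    rw [wn_smul _ (by linarith), wn_smul _ hlam0.le] at q2
    have q3 : (fun i => z (k + 1) i - xs) = fun i => (1 - lam) • (x (k + 1) i - xs)
      + lam • (p (k + 1) i - xs) := by
      funext i; rw [hz]; module
    rw [q3] at q1
    have q4 := mul_le_mul_of_nonneg_left (hpw (k + 1)) hlam0.le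
    have q2' := q1.trans q2
    have q5 : wn (φ (k + 1)) (fun i => x (k + 1) i - xs) = e (k + 1) := rfl
    rw [q5] at q2'
    linarith
  have hDk : ∀ k, D (k + 2) ≤ σ * (D (k + 1) + lam * G (k + 1)) := by
    intro k
    have q1 : D (k + 2) ≤ σ * wn (φ (k + 1)) (fun i => z (k + 1) i - ∑ j, φ (k + 1) j • z (k + 1) j) := by
      have := hRcontr (k + 1) (z (k + 1))
      rw [← hxhz] at this
      simp only [← hxiter] at this
      rw [← hxhz]
      exact this
    refine q1.trans (mul_le_mul_of_nonneg_left ?_ hσ0.le)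
    rw [← hxhz, hxhd]
    have q2 : (fun i => z (k + 1) i - (xh (k + 1) + lam • ∑ j, φ (k + 1) j • (p (k + 1) j - x (k + 1) j)))
      = fun i => (x (k + 1) i - xh (k + 1)) + lam • ((p (k + 1) i - x (k + 1) i)
        - ∑ j, φ (k + 1) j • (p (k + 1) j - x (k + 1) j)) := by
      funext i; rw [hz2, smul_sub lam (p (k + 1) i - x (k + 1) i)]; abel
    rw [q2]
    refine (wn_add (hφ0 _) _ _).trans ?_
    rw [wn_smul _ hlam0.le]
    have := mul_le_mul_of_nonneg_left
      (wn_var_le (hφ0 (k + 1)) (hφsum (k + 1)) (fun i => p (k + 1) i - x (k + 1) i)) hlam0.le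
    exact add_le_add le_rfl this
  have hΔ : ∀ k, wn (fun _ => 1) (fun i => x (k + 2) i - x (k + 1) i)
      ≤ φbar * (1 + σ) * (D (k + 1) + lam * G (k + 1)) := by
    intro k
    have q0 : (fun i => x (k + 2) i - x (k + 1) i) = fun i => ((x (k + 2) i - xh (k + 2))
        + (xh (k + 2) - xh (k + 1))) + (xh (k + 1) - x (k + 1) i) := by
      funext i; abel
    have one0 : ∀ i : Fin n, (0 : ℝ) ≤ (fun _ : Fin n => (1 : ℝ)) i := fun _ => zero_le_one
    have q1 := wn_add one0 (fun i => (x (k + 2) i - xh (k + 2)) + (xh (k + 2) - xh (k + 1)))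
      (fun i => xh (k + 1) - x (k + 1) i)
    have q2 := wn_add one0 (fun i => (x (k + 2) i - xh (k + 2)))
      (fun _ => (xh (k + 2) - xh (k + 1)))
    have q3 : wn (fun _ => 1) (fun i => (x (k + 2) i - xh (k + 2))) ≤ φbar * D (k + 2) := by
      rw [hφbar]; exact wn_one_le hφmin0 (hφmin (k + 2)) _
    have q4 : wn (fun _ => 1) (fun i => (xh (k + 1) - x (k + 1) i)) ≤ φbar * D (k + 1) := by
      refine le_trans (wn_mono' one0 _ (fun i => x (k + 1) i - xh (k + 1))
        fun i => by rw [norm_sub_rev]) ?_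
      rw [hφbar]; exact wn_one_le hφmin0 (hφmin (k + 1)) _
    have q5 : wn (fun _ : Fin n => 1) (fun _ => (xh (k + 2) - xh (k + 1))) ≤ φbar * (lam * G (k + 1)) := by
      have w1 : wn (fun _ : Fin n => 1) (fun _ => (xh (k + 2) - xh (k + 1)))
          = Real.sqrt n * ‖xh (k + 2) - xh (k + 1)‖ := by
        unfold wn
        simp
      rw [w1]
      refine mul_le_mul hsnφ ?_ (norm_nonneg _) hφb0
      rw [hxhd, add_sub_cancel_left, norm_smul, Real.norm_of_nonneg hlam0.le]
      exact mul_le_mul_of_nonneg_left (norm_mean_le (hφ0 _) (hφsum _) _) hlam0.le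
    have q6 := mul_le_mul_of_nonneg_left (hDk k) hφb0
    rw [q0]
    linarith
  have hSk : ∀ k, η * S (k + 2) ≤ τ * (η * S (k + 1)) + (φbar * sψ * (1 + σ)) *
      (D (k + 1) + lam * G (k + 1)) := by
    intro k
    set gd : Fin n → EuclideanSpace ℝ (Fin d) := fun i =>
      gradient (f i) (x (k + 2) i) - gradient (f i) (x (k + 1) i) with hgd
    have hy2 : ∀ i, y (k + 2) i = (∑ j, C (k + 1) i j • y (k + 1) j) + gd i := by
      intro i; rw [hyiter, hgd, add_sub_assoc]
    have hY2 : ∑ l, y (k + 2) l = ∑ l, y (k + 1) l + ∑ l, gd l := by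
      rw [hsumy, hsumy, hgd, Finset.sum_sub_distrib]; abel
    have hmean : ∑ j, π (k + 2) j • ((π (k + 2) j)⁻¹ • gd j) = ∑ l, gd l :=
      Finset.sum_congr rfl fun j _ => smul_inv_smul₀ (hπpos _ j).ne' _
    have q1 := wn_add (hπ0 (k + 2))
      (fun i => (π (k + 2) i)⁻¹ • (∑ j, C (k + 1) i j • y (k + 1) j) - ∑ l, y (k + 1) l)
      (fun i => (π (k + 2) i)⁻¹ • gd i - ∑ l, gd l)
    have q2 : S (k + 2) = wn (π (k + 2)) (fun i =>
      ((π (k + 2) i)⁻¹ • (∑ j, C (k + 1) i j • y (k + 1) j) - ∑ l, y (k + 1) l) +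
      ((π (k + 2) i)⁻¹ • gd i - ∑ l, gd l)) := by
      simp only [hS_def]
      congr 1
      funext i
      rw [hY2, hy2, smul_add]; abel
    have q3 : wn (π (k + 2))
      (fun i => (π (k + 2) i)⁻¹ • (∑ j, C (k + 1) i j • y (k + 1) j) - ∑ l, y (k + 1) l)
      ≤ τ * S (k + 1) := hCcontr (k + 1) (y (k + 1))
    have q4 := wn_var_le (hπ0 (k + 2)) (hπsum (k + 2)) (fun i => (π (k + 2) i)⁻¹ • gd i)
    rw [hmean] at q4
    have q5 : wn (π (k + 2)) (fun i => (π (k + 2) i)⁻¹ • gd i) ≤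
        wn (fun _ => 1) (fun i => (sψ * L) • (x (k + 2) i - x (k + 1) i)) := by
      refine wn_mono _ _ fun i => ?_
      have w0 : ‖gd i‖ ^ 2 ≤ (L * ‖x (k + 2) i - x (k + 1) i‖) ^ 2 :=
        pow_le_pow_left₀ (norm_nonneg _) (hsmooth i _ _) 2
      have hpp := hπpos (k + 2) i
      have w1 : (π (k + 2) i)⁻¹ ≤ 1 / ψ := by
        rw [one_div]; exact inv_anti₀ hψ0 (hψ _ _)
      have w2 : sψ ^ 2 = 1 / ψ := Real.sq_sqrt (by positivity)
      have w3 : π (k + 2) i * ‖(π (k + 2) i)⁻¹ • gd i‖ ^ 2 = (π (k + 2) i)⁻¹ * ‖gd i‖ ^ 2 := by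
        rw [norm_smul, Real.norm_of_nonneg (inv_pos.2 hpp).le]; field_simp
      rw [w3, norm_smul, Real.norm_of_nonneg (by positivity), one_mul]
      calc (π (k + 2) i)⁻¹ * ‖gd i‖ ^ 2 ≤ (1 / ψ) * (L * ‖x (k + 2) i - x (k + 1) i‖) ^ 2 :=
            mul_le_mul w1 w0 (sq_nonneg _) (by positivity)
        _ = (sψ * L * ‖x (k + 2) i - x (k + 1) i‖) ^ 2 := by rw [← w2]; ring
    rw [wn_smul _ (by positivity)] at q5
    have q6 := mul_le_mul_of_nonneg_left (hΔ k) (show 0 ≤ sψ * L by positivity)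
    have q7 : S (k + 2) ≤ τ * S (k + 1) + sψ * L * (φbar * (1 + σ) * (D (k + 1) + lam * G (k + 1))) := by
      rw [q2]; linarith
    have q8 := mul_le_mul_of_nonneg_left q7 hη0.le
    have hT : 0 ≤ sψ * (φbar * (1 + σ) * (D (k + 1) + lam * G (k + 1))) := by
      have := hD0 (k + 1)
      have := hG0 (k + 1)
      positivity
    have hηL' : η * L ≤ 1 := by
      have := mul_le_mul_of_nonneg_left hn1 (mul_pos hη0 hL).le
      linarith
    have q9 := mul_le_mul_of_nonneg_right hηL' hT
    linarith
  obtain ⟨δ, ς, hδ, hς, h1, h2, h3⟩ := param_choice lam c σ τ φbar sψ (Real.sqrt n) r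
    (φbar * sψ * (1 + σ)) hlam0 hσ0 hσ1 hτ0 hτ1 hφb1 hsψ hsn hr le_rfl hpar
  obtain ⟨V, ρ, hV, hρ0, hρ1, hfin⟩ := rec_bound (fun k => e (k + 1)) (fun k => D (k + 1))
    (fun k => η * S (k + 1)) (fun k => G (k + 1)) lam c (1 + φbar) σ τ (φbar * sψ * (1 + σ)) δ ς
    hδ hς hlam0 hl1 hc1 (by positivity) hσ0.le hτ0.le (by positivity) (he0 1) hE hDk hSk
    (fun k => hGk (k + 1)) h1 h2 h3
  have hei : ∀ k i, ‖x k i - xs‖ ≤ φbar * e k := by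
    intro k i
    rw [hφbar]
    exact norm_le_wn (hφ0 k) hφmin0 (hφmin k) (fun i => x k i - xs) i
  have hb : ∀ (i : Fin n) (k : ℕ), ‖x k i - xs‖ ≤ (φbar * (e 0 + V / ρ)) * ρ ^ k := by
    intro i k
    rw [mul_assoc]
    refine (hei k i).trans (mul_le_mul_of_nonneg_left ?_ hφb0)
    rcases k with _ | k
    · have : 0 ≤ V / ρ := by positivity
      simpa using this
    · refine (hfin k).trans ?_
      have w1 : V / ρ * ρ ^ (k + 1) = V * ρ ^ k := by
        field_simp
        ring
      have w2 : 0 ≤ e 0 * ρ ^ (k + 1) := mul_nonneg (he0 0) (by positivity)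
      rw [add_mul, w1]; linarith
  refine ⟨φbar * (e 0 + V / ρ), ρ,
    mul_nonneg hφb0 (add_nonneg (he0 0) (by positivity)), hρ0.le, hρ1, hb, fun i => ?_⟩
  refine squeeze_zero (fun k => norm_nonneg _) (hb i) ?_
  simpa using (tendsto_pow_atTop_nhds_zero_of_lt_one hρ0.le hρ1).const_mul (φbar * (e 0 + V / ρ))
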